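/- arXiv:2203.00243 — 3 statements merged into one kernel-verified Lean document; each statement's English description precedes it below -/
import Mathlib

section
/- For every 0 ≤ i < j ≤ p and every n ≥ j one has A_{[n,j]} = Σ_{k=i}^{n−j+i} A_{[k,i]} · A^{(i+1)}_{[n−k−1,j−i−1]}. (Equivalently, in terms of generating series, A_j(z) = A_i(z)·A^{(i+1)}_{j−i−1}(z) for all 0 ≤ i < j ≤ p.) -/
open Finset

/-- The height of the path `γ` after `k` steps, starting at height `h0`.
A step encoded by `v : Fin (p + 2)` changes the height by `1 - v`:
`v = 0` is an upstep, `v = 1` a level step and `v = j + 1` a downstep of size `j`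
(for `1 ≤ j ≤ p`). -/
def ht {p n : ℕ} (h0 : ℤ) (γ : Fin n → Fin (p + 2)) (k : ℕ) : ℤ :=
  h0 + ∑ i ∈ Finset.range k, (if h : i < n then 1 - ((γ ⟨i, h⟩ : ℕ) : ℤ) else 0)

/-- The weight of the path `γ` started at height `h0`: upsteps have weight `1`,
a level step at height `m` has weight `a 0 m`, and a downstep of size `j` from
height `m` has weight `a j (m - j)`, i.e. `a j` evaluated at the final height. -/
noncomputable def wt (a : ℕ → ℤ → ℂ) {p n : ℕ} (h0 : ℤ) (γ : Fin n → Fin (p + 2)) : ℂ :=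
  ∏ i : Fin n,
    if (γ i : ℕ) = 0 then 1 else a ((γ i : ℕ) - 1) (ht h0 γ ((i : ℕ) + 1))

open Classical in
/-- `𝒟_{[n,j]}`: the paths of length `n` from `(0,0)` to `(n,j)` whose vertices
all have height `≥ 0`. -/
noncomputable def Dset (p n j : ℕ) : Finset (Fin n → Fin (p + 2)) :=
  Finset.univ.filter fun γ => ht 0 γ n = (j : ℤ) ∧ ∀ k ≤ n, 0 ≤ ht 0 γ k

open Classical in
/-- `𝒫_{[n,j]}`: all paths of length `n` from `(0,0)` to `(n,j)`. -/
noncomputable def Pset (p n j : ℕ) : Finset (Fin n → Fin (p + 2)) :=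
  Finset.univ.filter fun γ => ht 0 γ n = (j : ℤ)

open Classical in
/-- `𝒟̂_{[n,j]}`: the paths of length `n` from `(0,-j)` to `(n,0)` whose vertices
all have height `≤ 0`. -/
noncomputable def Bhset (p n j : ℕ) : Finset (Fin n → Fin (p + 2)) :=
  Finset.univ.filter fun γ =>
    ht (-(j : ℤ)) γ n = 0 ∧ ∀ k ≤ n, ht (-(j : ℤ)) γ k ≤ 0

/-- The weight polynomial `A^{(q)}_{[n,j]}` (so `A_{[n,j]} = Apoly a p 0 n j`):
the sum over `γ ∈ 𝒟_{[n,j]}` of the weight of the upward shift `γ + q`. -/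
noncomputable def Apoly (a : ℕ → ℤ → ℂ) (p : ℕ) (q : ℤ) (n j : ℕ) : ℂ :=
  ∑ γ ∈ Dset p n j, wt a q γ

/-- The weight polynomial `W_{[n,j]} = Σ_{γ ∈ 𝒫_{[n,j]}} w(γ)`. -/
noncomputable def Wpoly (a : ℕ → ℤ → ℂ) (p n j : ℕ) : ℂ :=
  ∑ γ ∈ Pset p n j, wt a 0 γ

/-- The weight polynomial `B^{(q)}_{[n,j]}`: the sum over `γ ∈ 𝒟̂_{[n,j]}` of the
weight of the downward shift `γ - q` (a path starting at height `-j - q`). -/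
noncomputable def Bpoly (a : ℕ → ℤ → ℂ) (p : ℕ) (q : ℤ) (n j : ℕ) : ℂ :=
  ∑ γ ∈ Bhset p n j, wt a (-(j : ℤ) - q) γ

open Classical in
noncomputable def Fpaths (a : ℕ → ℤ → ℂ) (p : ℕ) (q : ℤ) (n : ℕ) (m : ℤ) : ℂ :=
  ∑ γ : Fin n → Fin (p + 2), if (ht 0 γ n = m ∧ ∀ k ≤ n, 0 ≤ ht 0 γ k) then wt a q γ else 0

noncomputable def cst (a : ℕ → ℤ → ℂ) (v : ℕ) (m : ℤ) : ℂ := if v = 0 then 1 else a (v - 1) m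

theorem Apoly_eq_F (a : ℕ → ℤ → ℂ) (p : ℕ) (q : ℤ) (n j : ℕ) :
    Apoly a p q n j = Fpaths a p q n j := by
  unfold Apoly Dset Fpaths
  rw [Finset.sum_filter]

theorem ht_shift {p n : ℕ} (h0 : ℤ) (γ : Fin n → Fin (p + 2)) (k : ℕ) :
    ht h0 γ k = h0 + ht 0 γ k := by
  simp [ht]

theorem ht_snoc_le {p n : ℕ} (h0 : ℤ) (γ : Fin n → Fin (p + 2)) (v : Fin (p + 2)) (k : ℕ)
    (hk : k ≤ n) :
    ht h0 (Fin.snoc γ v : Fin (n + 1) → Fin (p + 2)) k = ht h0 γ k := by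
  unfold ht
  congr 1
  refine Finset.sum_congr rfl fun x hx => ?_
  have hx' : x < n := lt_of_lt_of_le (Finset.mem_range.1 hx) hk
  rw [dif_pos hx', dif_pos (by omega)]
  have : (⟨x, by omega⟩ : Fin (n + 1)) = Fin.castSucc ⟨x, hx'⟩ := rfl
  rw [this, Fin.snoc_castSucc (α := fun _ => Fin (p + 2))]

theorem ht_snoc_last {p n : ℕ} (h0 : ℤ) (γ : Fin n → Fin (p + 2)) (v : Fin (p + 2)) :
    ht h0 (Fin.snoc γ v : Fin (n + 1) → Fin (p + 2)) (n + 1) = ht h0 γ n + (1 - ((v : ℕ) : ℤ)) := by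
  rw [← ht_snoc_le h0 γ v n le_rfl]
  unfold ht
  rw [Finset.sum_range_succ, dif_pos (by omega), ← add_assoc]
  have : (⟨n, by omega⟩ : Fin (n + 1)) = Fin.last n := rfl
  rw [this, Fin.snoc_last (α := fun _ => Fin (p + 2))]

theorem wt_snoc (a : ℕ → ℤ → ℂ) {p n : ℕ} (q : ℤ) (γ : Fin n → Fin (p + 2)) (v : Fin (p + 2)) :
    wt a q (Fin.snoc γ v : Fin (n + 1) → Fin (p + 2)) =
      wt a q γ * cst a v (q + ht 0 γ n + (1 - ((v : ℕ) : ℤ))) := by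
  unfold wt
  rw [Fin.prod_univ_castSucc]
  congr 1
  · refine Finset.prod_congr rfl fun x _ => ?_
    rw [Fin.snoc_castSucc (α := fun _ => Fin (p + 2)), ht_snoc_le _ _ _ _ (by simp)]
    rfl
  · rw [Fin.snoc_last (α := fun _ => Fin (p + 2)), Fin.val_last, ht_snoc_last, ht_shift]
    rfl

theorem F_succ (a : ℕ → ℤ → ℂ) (p : ℕ) (q : ℤ) (n : ℕ) (m : ℤ) (hm : 0 ≤ m) :
    Fpaths a p q (n + 1) m =
      ∑ v : Fin (p + 2), Fpaths a p q n (m - 1 + (v : ℕ)) * cst a v (q + m) := by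
  unfold Fpaths
  rw [← (Fin.snocEquiv (fun _ : Fin (n + 1) => Fin (p + 2))).sum_comp, Fintype.sum_prod_type]
  refine Finset.sum_congr rfl fun v _ => ?_
  rw [Finset.sum_mul]
  refine Finset.sum_congr rfl fun γ _ => ?_
  change (if (ht 0 (Fin.snoc γ v : Fin (n + 1) → Fin (p + 2)) (n + 1) = m ∧
    ∀ k ≤ n + 1, 0 ≤ ht 0 (Fin.snoc γ v : Fin (n + 1) → Fin (p + 2)) k) then
      wt a q (Fin.snoc γ v : Fin (n + 1) → Fin (p + 2)) else 0) = _
  have hiff : (ht 0 (Fin.snoc γ v : Fin (n + 1) → Fin (p + 2)) (n + 1) = m ∧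
    ∀ k ≤ n + 1, 0 ≤ ht 0 (Fin.snoc γ v : Fin (n + 1) → Fin (p + 2)) k) ↔
    (ht 0 γ n = m - 1 + (v : ℕ) ∧ ∀ k ≤ n, 0 ≤ ht 0 γ k) := by
    constructor
    · rintro ⟨h1, h2⟩
      rw [ht_snoc_last] at h1
      refine ⟨by linarith, fun k hk => ?_⟩
      rw [← ht_snoc_le 0 γ v k hk]
      exact h2 k (by omega)
    · rintro ⟨h1, h2⟩
      have h3 : ht 0 (Fin.snoc γ v : Fin (n + 1) → Fin (p + 2)) (n + 1) = m := by
        rw [ht_snoc_last]; linarith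
      refine ⟨h3, fun k hk => ?_⟩
      rcases Nat.lt_or_ge n k with h | h
      · have : k = n + 1 := by omega
        rw [this, h3]; exact hm
      · rw [ht_snoc_le 0 γ v k h]; exact h2 k h
  by_cases hc : (ht 0 γ n = m - 1 + (v : ℕ) ∧ ∀ k ≤ n, 0 ≤ ht 0 γ k)
  · rw [if_pos hc, if_pos (hiff.2 hc), wt_snoc, hc.1]
    congr 2
    ring
  · rw [if_neg hc, if_neg (fun h => hc (hiff.1 h)), zero_mul]

theorem F_zero (a : ℕ → ℤ → ℂ) (p : ℕ) (q : ℤ) (m : ℤ) :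
    Fpaths a p q 0 m = if m = 0 then 1 else 0 := by
  simp [Fpaths, ht, wt, eq_comm]

theorem F_neg (a : ℕ → ℤ → ℂ) (p : ℕ) (q : ℤ) (n : ℕ) (m : ℤ) (hm : m < 0) :
    Fpaths a p q n m = 0 := by
  unfold Fpaths
  refine Finset.sum_eq_zero fun γ _ => if_neg ?_
  rintro ⟨h1, h2⟩
  have := h2 n le_rfl
  omega

theorem F_big (a : ℕ → ℤ → ℂ) (p : ℕ) (q : ℤ) (n : ℕ) (m : ℤ) (hm : (n : ℤ) < m) :
    Fpaths a p q n m = 0 := by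
  induction n generalizing m with
  | zero => rw [F_zero, if_neg]; push_cast at hm; omega
  | succ n ih =>
    push_cast at hm
    rw [F_succ _ _ _ _ _ (by omega)]
    refine Finset.sum_eq_zero fun v _ => ?_
    rw [ih _ (by omega), zero_mul]

theorem F_main (a : ℕ → ℤ → ℂ) (p : ℕ) (i n : ℕ) (m : ℤ) (hm : (i : ℤ) < m) :
    Fpaths a p 0 n m = ∑ k ∈ Finset.range n,
      Fpaths a p 0 k i * Fpaths a p ((i : ℤ) + 1) (n - k - 1) (m - i - 1) := by
  induction n generalizing m with
  | zero => rw [F_zero, if_neg (by omega)]; simp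
  | succ n ih =>
    have key : ∀ k ∈ Finset.range n,
        Fpaths a p 0 k i * Fpaths a p ((i : ℤ) + 1) (n + 1 - k - 1) (m - i - 1) =
        ∑ v : Fin (p + 2), Fpaths a p 0 k i *
          Fpaths a p ((i : ℤ) + 1) (n - k - 1) (m - 1 + (v : ℕ) - i - 1) * cst a v m := by
      intro k hk
      have hk := Finset.mem_range.1 hk
      have e : n + 1 - k - 1 = (n - k - 1) + 1 := by omega
      rw [e, F_succ _ _ _ _ _ (by omega), Finset.mul_sum]
      refine Finset.sum_congr rfl fun v _ => ?_
      rw [mul_assoc]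
      congr 3 <;> ring
    rw [Finset.sum_range_succ, Finset.sum_congr rfl key, Finset.sum_comm,
      F_succ _ _ _ _ _ (by omega)]
    have e0 : n + 1 - n - 1 = 0 := by omega
    rw [e0, F_zero]
    simp only [← Finset.sum_mul]
    by_cases h : m = i + 1
    · subst h
      rw [Fin.sum_univ_succ, Fin.sum_univ_succ (n := p + 1)]
      have h0 : ∑ k ∈ Finset.range n, Fpaths a p 0 k i *
          Fpaths a p ((i : ℤ) + 1) (n - k - 1)
            ((i : ℤ) + 1 - 1 + (((0 : Fin (p + 2)) : ℕ) : ℤ) - i - 1) = 0 := by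
        refine Finset.sum_eq_zero fun k _ => ?_
        rw [F_neg a p ((i : ℤ) + 1) (n - k - 1) _ (by simp), mul_zero]
      rw [h0, if_pos (by ring), zero_mul, zero_add (Finset.sum _ _), add_comm]
      congr 1
      · refine Finset.sum_congr rfl fun v _ => ?_
        rw [ih _ (by rw [Fin.val_succ]; omega), zero_add]
      · simp [cst]
    · rw [if_neg (by omega), mul_zero, add_zero]
      refine Finset.sum_congr rfl fun v _ => ?_
      rw [ih _ (by omega), zero_add]

/-- For every `0 ≤ i < j ≤ p` and `n ≥ j`,
`A_{[n,j]} = Σ_{k=i}^{n-j+i} A_{[k,i]} · A^{(i+1)}_{[n-k-1,j-i-1]}`. -/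
theorem stmt2 (p : ℕ) (hp : 1 ≤ p) (a : ℕ → ℤ → ℂ) (i j n : ℕ)
    (hij : i < j) (hjp : j ≤ p) (hn : j ≤ n) :
    Apoly a p 0 n j =
      ∑ k ∈ Finset.Icc i (n - j + i),
        Apoly a p 0 k i * Apoly a p ((i : ℤ) + 1) (n - k - 1) (j - i - 1) := by
  simp only [Apoly_eq_F]
  rw [F_main a p i n j (by exact_mod_cast hij)]
  symm
  have hc : ((j - i - 1 : ℕ) : ℤ) = (j : ℤ) - i - 1 := by omega
  rw [hc]
  refine Finset.sum_subset ?_ ?_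
  · intro k hk
    have := Finset.mem_Icc.1 hk
    exact Finset.mem_range.2 (by omega)
  · intro k hk hk2
    have hk := Finset.mem_range.1 hk
    rw [Finset.mem_Icc] at hk2
    rcases Nat.lt_or_ge k i with h | h
    · rw [F_big _ _ _ _ _ (by exact_mod_cast h), zero_mul]
    · rw [F_big a p _ (n - k - 1) _ (by omega), mul_zero]
end

section
/- For every m ≥ 0 and 0 ≤ j ≤ p, T_{[m(p+1)+j, j]} = Σ_{i₁=−j−p}^{−p} Σ_{i₂=i₁−p}^{−p} Σ_{i₃=i₂−p}^{−p} ⋯ Σ_{i_m=i_{m−1}−p}^{−p} Π_{k=1}^{m} a_{i_k}, where the right-hand side is understood to be 1 when m = 0. -/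
open Finset

/-- The height of the path `γ` after `k` steps, starting at height `h0`.
A step with `γ i = false` is an upstep (height change `+1`) and a step with
`γ i = true` is a downstep by `p` units (height change `-p`). -/
def htB (p : ℕ) {n : ℕ} (h0 : ℤ) (γ : Fin n → Bool) (k : ℕ) : ℤ :=
  h0 + ∑ i ∈ Finset.range k,
    (if h : i < n then (if γ ⟨i, h⟩ then -(p : ℤ) else 1) else 0)

/-- The weight of the path `γ` started at height `h0`: upsteps have weight `1` and
a downstep from height `m` has weight `a (m - p)`, i.e. `a` evaluated at its final
height. -/
noncomputable def wtB (a : ℤ → ℂ) (p : ℕ) {n : ℕ} (h0 : ℤ) (γ : Fin n → Bool) : ℂ :=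
  ∏ i : Fin n, if γ i then a (htB p h0 γ ((i : ℕ) + 1)) else 1

open Classical in
/-- `ℛ_{[n,j]}`: all paths of length `n` from `(0,0)` to `(n,j)` with upsteps and
downsteps by `p` (heights may be negative). -/
noncomputable def Rset (p n j : ℕ) : Finset (Fin n → Bool) :=
  Finset.univ.filter fun γ => htB p 0 γ n = (j : ℤ)

open Classical in
/-- `𝒮_{[n,j]}`: the paths in `ℛ_{[n,j]}` whose vertices all have height `≥ 0`
(partial `p`-Dyck paths). -/
noncomputable def Sset (p n j : ℕ) : Finset (Fin n → Bool) :=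
  Finset.univ.filter fun γ => htB p 0 γ n = (j : ℤ) ∧ ∀ k ≤ n, 0 ≤ htB p 0 γ k

open Classical in
/-- `Ŝ_{[n,j]}`: the paths of length `n` from `(0,-j)` to `(n,0)` whose vertices
all have height `≤ 0`. -/
noncomputable def Shatset (p n j : ℕ) : Finset (Fin n → Bool) :=
  Finset.univ.filter fun γ =>
    htB p (-(j : ℤ)) γ n = 0 ∧ ∀ k ≤ n, htB p (-(j : ℤ)) γ k ≤ 0

/-- The weight polynomial `R_{[n,j]} = Σ_{γ ∈ ℛ_{[n,j]}} w(γ)`. -/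
noncomputable def Rpoly (a : ℤ → ℂ) (p n j : ℕ) : ℂ :=
  ∑ γ ∈ Rset p n j, wtB a p 0 γ

/-- The weight polynomial `S^{(q)}_{[n,j]}` (so `S_{[n,j]} = Spoly a p 0 n j`):
the sum over `γ ∈ 𝒮_{[n,j]}` of the weight of the upward shift `γ + q`. -/
noncomputable def Spoly (a : ℤ → ℂ) (p : ℕ) (q : ℤ) (n j : ℕ) : ℂ :=
  ∑ γ ∈ Sset p n j, wtB a p q γ

/-- The weight polynomial `T_{[n,j]} = Σ_{γ ∈ Ŝ_{[n,j]}} w(γ)`. -/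
noncomputable def Tpoly (a : ℤ → ℂ) (p n j : ℕ) : ℂ :=
  ∑ γ ∈ Shatset p n j, wtB a p (-(j : ℤ)) γ

def Hcond (p : ℕ) {n : ℕ} (s : ℤ) (γ : Fin n → Bool) : Prop :=
  htB p s γ n = 0 ∧ ∀ k ≤ n, htB p s γ k ≤ 0

open Classical in
noncomputable def Qpoly (a : ℤ → ℂ) (p n : ℕ) (s : ℤ) : ℂ :=
  ∑ γ : Fin n → Bool, if Hcond p s γ then wtB a p s γ else 0

noncomputable def Fnest (a : ℤ → ℂ) (p : ℕ) : ℕ → ℤ → ℂ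
  | 0, _ => 1
  | m + 1, s => ∑ i ∈ Finset.Icc (s - p) (-(p : ℤ)), a i * Fnest a p m i

noncomputable def Bset (p : ℕ) : (m : ℕ) → ℤ → Finset (Fin m → ℤ)
  | 0, _ => Finset.univ
  | m + 1, s => (Finset.Icc (s - p) (-(p : ℤ))).biUnion fun i =>
      (Bset p m i).image (fun f => (Fin.cons i f : Fin (m + 1) → ℤ))

theorem htB_zero (p : ℕ) {n : ℕ} (s : ℤ) (γ : Fin n → Bool) : htB p s γ 0 = s := by
  simp [htB]

theorem htB_cons (p : ℕ) {n : ℕ} (s : ℤ) (b : Bool) (γ : Fin n → Bool) (k : ℕ) :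
    htB p s (Fin.cons b γ : Fin (n + 1) → Bool) (k + 1)
      = htB p (s + (if b then -(p : ℤ) else 1)) γ k := by
  unfold htB
  rw [Finset.sum_range_succ']
  have h0 : (if h : 0 < n + 1 then
      (if (Fin.cons b γ : Fin (n + 1) → Bool) ⟨0, h⟩ then -(p : ℤ) else 1) else 0)
      = if b then -(p : ℤ) else 1 := by
    rw [dif_pos (Nat.succ_pos n)]; rfl
  have h1 : ∀ i, (if h : i + 1 < n + 1 then
      (if (Fin.cons b γ : Fin (n + 1) → Bool) ⟨i + 1, h⟩ then -(p : ℤ) else 1) else 0)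
      = if h : i < n then (if γ ⟨i, h⟩ then -(p : ℤ) else 1) else 0 := by
    intro i
    by_cases h : i < n
    · rw [dif_pos h, dif_pos (Nat.succ_lt_succ h)]; rfl
    · rw [dif_neg h, dif_neg (by omega)]
  rw [h0, Finset.sum_congr rfl (fun i _ => h1 i)]
  ring

theorem wtB_cons (a : ℤ → ℂ) (p : ℕ) {n : ℕ} (s : ℤ) (b : Bool) (γ : Fin n → Bool) :
    wtB a p s (Fin.cons b γ : Fin (n + 1) → Bool)
      = (if b then a (s - p) else 1) * wtB a p (s + (if b then -(p : ℤ) else 1)) γ := by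
  unfold wtB
  rw [Fin.prod_univ_succ]
  congr 1
  · simp only [Fin.cons_zero, Fin.val_zero, htB_cons, htB_zero]
    cases b <;> simp [sub_eq_add_neg]
  · refine Finset.prod_congr rfl fun i _ => ?_
    simp only [Fin.cons_succ, Fin.val_succ, htB_cons]

theorem Hcond_cons (p : ℕ) {n : ℕ} (s : ℤ) (hs : s ≤ 0) (b : Bool) (γ : Fin n → Bool) :
    Hcond p s (Fin.cons b γ : Fin (n + 1) → Bool)
      ↔ Hcond p (s + (if b then -(p : ℤ) else 1)) γ := by
  unfold Hcond
  rw [htB_cons]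
  refine and_congr_right fun _ => ⟨fun h k hk => ?_, fun h k hk => ?_⟩
  · rw [← htB_cons]; exact h _ (by omega)
  · cases k with
    | zero => rw [htB_zero]; exact hs
    | succ k => rw [htB_cons]; exact h _ (by omega)

theorem Qpoly_pos (a : ℤ → ℂ) (p n : ℕ) (s : ℤ) (hs : 0 < s) : Qpoly a p n s = 0 := by
  unfold Qpoly
  refine Finset.sum_eq_zero fun γ _ => if_neg fun h => ?_
  have := h.2 0 (Nat.zero_le _)
  rw [htB_zero] at this
  omega

theorem Qpoly_zero (a : ℤ → ℂ) (p : ℕ) (s : ℤ) :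
    Qpoly a p 0 s = if s = 0 then 1 else 0 := by
  unfold Qpoly
  rw [Fintype.sum_unique]
  have this : ∀ γ : Fin 0 → Bool, Hcond p s γ ↔ s = 0 := by
    intro γ
    unfold Hcond
    rw [htB_zero]
    refine ⟨fun h => h.1, fun h => ⟨h, fun k hk => ?_⟩⟩
    obtain rfl : k = 0 := by omega
    rw [htB_zero]; omega
  by_cases h : s = 0
  · rw [if_pos ((this _).2 h), if_pos h]; simp [wtB]
  · rw [if_neg (fun h' => h ((this _).1 h')), if_neg h]

theorem Qpoly_succ (a : ℤ → ℂ) (p n : ℕ) (s : ℤ) (hs : s ≤ 0) :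
    Qpoly a p (n + 1) s = Qpoly a p n (s + 1) + a (s - p) * Qpoly a p n (s - p) := by
  classical
  unfold Qpoly
  rw [← (Fin.consEquiv (fun _ : Fin (n + 1) => Bool)).sum_comp, Fintype.sum_prod_type,
    Fintype.sum_bool, add_comm, Finset.mul_sum]
  congr 1
  · refine Finset.sum_congr rfl fun γ _ => ?_
    have h1 := Hcond_cons p s hs false γ
    have h2 := wtB_cons a p s false γ
    simp only [Bool.false_eq_true, if_false, one_mul] at h1 h2
    simp only [Fin.consEquiv, Equiv.coe_fn_mk, h1, h2]
  · refine Finset.sum_congr rfl fun γ _ => ?_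
    have h1 := Hcond_cons p s hs true γ
    have h2 := wtB_cons a p s true γ
    simp only [if_true, ← sub_eq_add_neg] at h1 h2
    simp only [Fin.consEquiv, Equiv.coe_fn_mk, h1, h2, mul_ite, mul_zero]

theorem Qpoly_short (a : ℤ → ℂ) (p n : ℕ) : ∀ s : ℤ, s + n < 0 → Qpoly a p n s = 0 := by
  induction n with
  | zero => intro s hs; rw [Qpoly_zero, if_neg]; simp at hs; omega
  | succ n ih =>
    intro s hs
    push_cast at hs
    rw [Qpoly_succ _ _ _ _ (by omega), ih _ (by omega), ih _ (by omega)]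
    simp

theorem Fnest_step (a : ℤ → ℂ) (p m : ℕ) (s : ℤ) (hs : s ≤ 0) :
    Fnest a p (m + 1) s = Fnest a p (m + 1) (s + 1) + a (s - p) * Fnest a p m (s - p) := by
  simp only [Fnest]
  have : Finset.Icc (s - p) (-(p : ℤ))
      = insert (s - (p : ℤ)) (Finset.Icc (s + 1 - p) (-(p : ℤ))) := by
    ext x; simp only [Finset.mem_Icc, Finset.mem_insert]; omega
  rw [this, Finset.sum_insert (by simp only [Finset.mem_Icc]; omega), add_comm]

theorem Fnest_one (a : ℤ → ℂ) (p m : ℕ) : Fnest a p (m + 1) 1 = 0 := by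
  simp only [Fnest]
  rw [Finset.Icc_eq_empty (by omega), Finset.sum_empty]

theorem Qpoly_eq (a : ℤ → ℂ) (p n : ℕ) : ∀ (m h : ℕ), n = m * (p + 1) + h →
    Qpoly a p n (-(h : ℤ)) = Fnest a p m (-(h : ℤ)) := by
  induction n with
  | zero =>
    intro m h hn
    have h0 : h = 0 := by omega
    have hm : m = 0 := by
      have : m * (p + 1) = 0 := by omega
      simpa using this
    subst h0 hm
    simp [Qpoly_zero, Fnest]
  | succ n ih =>
    intro m h hn
    rw [Qpoly_succ _ _ _ _ (by omega)]
    cases m with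
    | zero =>
      obtain rfl : h = n + 1 := by simpa using hn.symm
      have h1 := ih 0 n (by simp)
      by_cases hp : p = 0 
      · rw [Qpoly_short a p n (-((n + 1 : ℕ) : ℤ) - p) (by push_cast; omega)]
        have e : -((n + 1 : ℕ) : ℤ) + 1 = -(n : ℤ) := by push_cast; ring
        rw [e, h1]; simp [Fnest]
      · rw [Qpoly_short a p n (-((n + 1 : ℕ) : ℤ) - p) (by push_cast; omega)]
        have e : -((n + 1 : ℕ) : ℤ) + 1 = -(n : ℤ) := by push_cast; ring
        rw [e, h1]; simp [Fnest]
    | succ m =>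
      rw [Fnest_step _ _ _ _ (by omega)]
      have h2 := ih m (h + p) (by rw [Nat.succ_mul] at hn; omega)
      have e : -(h : ℤ) - p = -((h + p : ℕ) : ℤ) := by push_cast; ring
      rw [e, h2]
      congr 1
      cases h with
      | zero =>
        rw [Qpoly_pos _ _ _ _ (by simp)]
        simpa using (Fnest_one a p m).symm
      | succ h =>
        have e : -((h + 1 : ℕ) : ℤ) + 1 = -(h : ℤ) := by push_cast; ring
        rw [e]
        exact ih (m + 1) h (by omega)

theorem sum_Bset (a : ℤ → ℂ) (p m : ℕ) : ∀ s : ℤ,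
    ∑ f ∈ Bset p m s, ∏ k, a (f k) = Fnest a p m s := by
  induction m with
  | zero => intro s; simp [Bset, Fnest]
  | succ m ih =>
    intro s
    simp only [Bset, Fnest]
    rw [Finset.sum_biUnion]
    · refine Finset.sum_congr rfl fun i _ => ?_
      rw [Finset.sum_image, ← ih i, Finset.mul_sum]
      · refine Finset.sum_congr rfl fun f _ => ?_
        rw [Fin.prod_univ_succ]; simp
      · intro f _ g _ h
        exact Fin.cons_right_injective (α := fun _ => ℤ) i h
    · intro i _ i' _ hne
      refine Finset.disjoint_left.2 fun f hf hf' => hne ?_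
      simp only [Finset.mem_image] at hf hf'
      obtain ⟨g, _, rfl⟩ := hf
      obtain ⟨g', _, h⟩ := hf'
      have := congrFun h 0
      simpa using this.symm

theorem mem_Bset (p m : ℕ) : ∀ (s : ℤ) (i : Fin m → ℤ), i ∈ Bset p m s ↔
    ∀ k : Fin m, i k ≤ -(p : ℤ) ∧ ((k : ℕ) = 0 → s - p ≤ i k) ∧
      ∀ k' : Fin m, (k' : ℕ) = (k : ℕ) + 1 → i k - p ≤ i k' := by
  induction m with
  | zero => intro s i; exact ⟨fun _ k => k.elim0, fun _ => Finset.mem_univ _⟩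
  | succ m ih =>
    intro s i
    simp only [Bset, Finset.mem_biUnion, Finset.mem_image, Finset.mem_Icc]
    constructor
    · rintro ⟨x, ⟨hx1, hx2⟩, f, hf, rfl⟩
      rw [ih] at hf
      intro k
      refine Fin.cases ?_ (fun k => ?_) k
      · refine ⟨by simpa using hx2, fun _ => by simpa using hx1, fun k' => ?_⟩
        refine Fin.cases ?_ (fun k' => ?_) k'
        · simp
        · intro h
          simp only [Fin.cons_succ, Fin.cons_zero]
          exact (hf k').2.1 (by simpa using h)
      · refine ⟨by simpa using (hf k).1, fun h => by simp at h, fun k' => ?_⟩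
        refine Fin.cases ?_ (fun k' => ?_) k'
        · simp
        · intro h
          simp only [Fin.cons_succ]
          exact (hf k).2.2 k' (by simpa using h)
    · intro h
      refine ⟨i 0, ⟨(h 0).2.1 rfl, (h 0).1⟩, Fin.tail i, ?_, Fin.cons_self_tail i⟩
      rw [ih]
      intro k
      refine ⟨(h k.succ).1, fun hk => (h 0).2.2 k.succ (by simp [hk]), fun k' hk' =>
        (h k.succ).2.2 k'.succ (by simp [hk'])⟩

/-- For every `m ≥ 0` and `0 ≤ j ≤ p`,
`T_{[m(p+1)+j,j]} = Σ_{i₁=-j-p}^{-p} Σ_{i₂=i₁-p}^{-p} ⋯ Σ_{i_m=i_{m-1}-p}^{-p} Π_{k=1}^{m} a_{i_k}`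
(the empty sum of products being `1` when `m = 0`); the nested sum is expressed as a
sum over the tuples `(i_0, …, i_{m-1})` satisfying the corresponding inequalities. -/
theorem stmt8 (p : ℕ) (hp : 1 ≤ p) (a : ℤ → ℂ) (m j : ℕ) (hj : j ≤ p) :
    Tpoly a p (m * (p + 1) + j) j =
      ∑ᶠ i ∈ {i : Fin m → ℤ |
        ∀ k : Fin m,
          i k ≤ -(p : ℤ) ∧
          ((k : ℕ) = 0 → -(j : ℤ) - p ≤ i k) ∧
          ∀ k' : Fin m, (k' : ℕ) = (k : ℕ) + 1 → i k - p ≤ i k'},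
        ∏ k, a (i k) := by
  classical
  have hT : Tpoly a p (m * (p + 1) + j) j = Qpoly a p (m * (p + 1) + j) (-(j : ℤ)) := by
    unfold Tpoly Qpoly Shatset
    rw [Finset.sum_filter]
    refine Finset.sum_congr rfl fun γ _ => ?_
    unfold Hcond
    congr
  rw [hT, Qpoly_eq a p _ m j rfl, ← sum_Bset, ← finsum_mem_coe_finset]
  refine congrArg (fun S : Set (Fin m → ℤ) => ∑ᶠ i ∈ S, ∏ k, a (i k)) ?_
  ext i
  exact mem_Bset p m _ i
end

section
/- For every 0 ≤ i < j ≤ p and every n ≥ j one has S_{[n,j]} = Σ_{k=i}^{n−j+i} S_{[k,i]} · S^{(i+1)}_{[n−k−1, j−i−1]}. (Equivalently, in terms of generating series, S_j(z) = S_i(z)·S^{(i+1)}_{j−i−1}(z) for all 0 ≤ i < j ≤ p.) -/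
open Finset

theorem htB_snoc_le (p n : ℕ) (h0 : ℤ) (γ : Fin n → Bool) (b : Bool) (k : ℕ) (hk : k ≤ n) :
    htB p h0 (Fin.snoc γ b : Fin (n+1) → Bool) k = htB p h0 γ k := by
  unfold htB
  congr 1
  apply Finset.sum_congr rfl
  intro i hi
  have hi' : i < n := lt_of_lt_of_le (Finset.mem_range.1 hi) hk
  have e : (Fin.snoc γ b : Fin (n+1) → Bool) ⟨i, by omega⟩ = γ ⟨i, hi'⟩ :=
    Fin.snoc_castSucc (α := fun _ => Bool) b γ ⟨i, hi'⟩
  rw [dif_pos hi', dif_pos (by omega : i < n + 1), e]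

theorem htB_snoc_last (p n : ℕ) (h0 : ℤ) (γ : Fin n → Bool) (b : Bool) :
    htB p h0 (Fin.snoc γ b : Fin (n+1) → Bool) (n+1)
      = htB p h0 γ n + (if b then -(p:ℤ) else 1) := by
  rw [← htB_snoc_le p n h0 γ b n le_rfl]
  unfold htB
  rw [Finset.sum_range_succ, ← add_assoc]
  congr 1
  have e : (Fin.snoc γ b : Fin (n+1) → Bool) ⟨n, by omega⟩ = b :=
    Fin.snoc_last (α := fun _ => Bool) b γ
  rw [dif_pos (by omega : n < n + 1), e]

theorem htB_shift (p n : ℕ) (h0 : ℤ) (γ : Fin n → Bool) (k : ℕ) :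
    htB p h0 γ k = h0 + htB p 0 γ k := by
  unfold htB; ring

theorem wtB_snoc (a : ℤ → ℂ) (p n : ℕ) (h0 : ℤ) (γ : Fin n → Bool) (b : Bool) :
    wtB a p h0 (Fin.snoc γ b : Fin (n+1) → Bool)
      = wtB a p h0 γ * (if b then a (htB p h0 γ n - p) else 1) := by
  unfold wtB
  rw [Fin.prod_univ_castSucc]
  congr 1
  · apply Finset.prod_congr rfl
    intro i _
    rw [Fin.snoc_castSucc (α := fun _ => Bool)]
    rw [Fin.val_castSucc, htB_snoc_le _ _ _ _ _ _ (by omega)]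
  · rw [Fin.snoc_last (α := fun _ => Bool), Fin.val_last, htB_snoc_last]
    cases b <;> simp [sub_eq_add_neg]

theorem mem_Sset' (p n j : ℕ) (γ : Fin n → Bool) :
    γ ∈ Sset p n j ↔ htB p 0 γ n = (j : ℤ) ∧ ∀ k ≤ n, 0 ≤ htB p 0 γ k := by
  simp [Sset]

theorem mem_Sset_snoc (p n j : ℕ) (γ : Fin n → Bool) (b : Bool) :
    (Fin.snoc γ b : Fin (n+1) → Bool) ∈ Sset p (n+1) j ↔
      htB p 0 γ n + (if b then -(p:ℤ) else 1) = j ∧ ∀ k ≤ n, 0 ≤ htB p 0 γ k := by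
  rw [mem_Sset', htB_snoc_last]
  refine and_congr_right fun h => ⟨fun H k hk => ?_, fun H k hk => ?_⟩
  · rw [← htB_snoc_le p n 0 γ b k hk]; exact H k (by omega)
  · rcases Nat.lt_or_ge n k with h1 | h1
    · obtain rfl : k = n + 1 := by omega
      rw [htB_snoc_last, h]; positivity
    · rw [htB_snoc_le p n 0 γ b k h1]; exact H k h1

open Classical in
theorem Spoly_eq (a : ℤ → ℂ) (p : ℕ) (q : ℤ) (n j : ℕ) :
    Spoly a p q n j = ∑ γ : Fin n → Bool, if γ ∈ Sset p n j then wtB a p q γ else 0 := by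
  simp [Spoly]

theorem Spoly_zero (a : ℤ → ℂ) (p : ℕ) (q : ℤ) (j : ℕ) :
    Spoly a p q 0 j = if j = 0 then 1 else 0 := by
  classical
  rw [Spoly_eq]
  simp only [mem_Sset']
  simp only [htB, wtB]
  rcases Nat.eq_zero_or_pos j with rfl | hj
  · simp
  · have h1 : j ≠ 0 := by omega
    have h2 : (0:ℤ) ≠ j := by omega
    simp [h1, h2]

theorem Spoly_succ (a : ℤ → ℂ) (p : ℕ) (q : ℤ) (n j : ℕ) :
    Spoly a p q (n+1) j = (if j = 0 then 0 else Spoly a p q n (j-1))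
      + a (q + j) * Spoly a p q n (j+p) := by
  classical
  rw [Spoly_eq, ← (Fin.snocEquiv (fun _ : Fin (n+1) => Bool)).sum_comp, Fintype.sum_prod_type]
  rw [Fintype.sum_bool, add_comm]
  congr 1
  · split_ifs with hj
    · apply Finset.sum_eq_zero
      intro γ _
      rw [if_neg]
      intro h
      have h := (mem_Sset_snoc p n j γ false).1 h
      have := h.2 n le_rfl
      have := h.1
      simp at this
      omega
    · rw [Spoly_eq]
      apply Finset.sum_congr rfl
      intro γ _
      change (if (Fin.snoc γ false : Fin (n+1) → Bool) ∈ _ then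
        wtB a p q (Fin.snoc γ false : Fin (n+1) → Bool) else 0) = _
      rw [wtB_snoc]
      have hiff : (Fin.snoc γ false : Fin (n+1) → Bool) ∈ Sset p (n+1) j ↔ γ ∈ Sset p n (j-1) := by
        rw [mem_Sset_snoc, mem_Sset']
        refine and_congr_left fun _ => ?_
        simp
        omega
      simp only [hiff]
      simp
  · rw [Spoly_eq, Finset.mul_sum]
    apply Finset.sum_congr rfl
    intro γ _
    change (if (Fin.snoc γ true : Fin (n+1) → Bool) ∈ _ then
        wtB a p q (Fin.snoc γ true : Fin (n+1) → Bool) else 0) = _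
    rw [wtB_snoc]
    have hiff : (Fin.snoc γ true : Fin (n+1) → Bool) ∈ Sset p (n+1) j ↔ γ ∈ Sset p n (j+p) := by
      rw [mem_Sset_snoc, mem_Sset']
      refine and_congr_left fun _ => ?_
      simp
      omega
    simp only [hiff]
    split_ifs with h
    · rw [htB_shift, ((mem_Sset' _ _ _ _).1 h).1, mul_comm]
      congr 2
      push_cast; ring
    · simp

theorem Spoly_lt (a : ℤ → ℂ) (p : ℕ) (q : ℤ) (n : ℕ) : ∀ j, n < j → Spoly a p q n j = 0 := by
  induction n with
  | zero => intro j hj; rw [Spoly_zero, if_neg (by omega)]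
  | succ n ih =>
    intro j hj
    rw [Spoly_succ, if_neg (by omega), ih _ (by omega), ih _ (by omega)]; simp

theorem Spoly_conv (a : ℤ → ℂ) (p i n : ℕ) : ∀ d,
    Spoly a p 0 n (i + 1 + d) =
      ∑ k ∈ Finset.range n, Spoly a p 0 k i * Spoly a p ((i : ℤ) + 1) (n - k - 1) d := by
  induction n with
  | zero => intro d; rw [Spoly_zero, if_neg (by omega)]; simp
  | succ n ih =>
    intro d
    rw [Spoly_succ, if_neg (by omega), Finset.sum_range_succ]
    have h : ∀ k ∈ Finset.range n,
        Spoly a p 0 k i * Spoly a p ((i : ℤ) + 1) (n + 1 - k - 1) d =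
        Spoly a p 0 k i * (if d = 0 then 0 else Spoly a p ((i : ℤ) + 1) (n - k - 1) (d-1))
        + a (0 + ((i + 1 + d : ℕ) : ℤ)) *
          (Spoly a p 0 k i * Spoly a p ((i : ℤ) + 1) (n - k - 1) (d+p)) := by
      intro k hk
      have hk := Finset.mem_range.1 hk
      rw [show n + 1 - k - 1 = (n - k - 1) + 1 by omega, Spoly_succ]
      push_cast
      rw [zero_add]
      ring
    rw [Finset.sum_congr rfl h, Finset.sum_add_distrib, ← Finset.mul_sum, ← ih,
      show n + 1 - n - 1 = 0 by omega, Spoly_zero, add_assoc (i+1) d p]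
    rcases Nat.eq_zero_or_pos d with rfl | hd
    · simp; ring
    · rw [if_neg (by omega), show i + 1 + d - 1 = i + 1 + (d - 1) by omega, ih]
      simp [show d ≠ 0 by omega]

/-- For every `0 ≤ i < j ≤ p` and `n ≥ j`,
`S_{[n,j]} = Σ_{k=i}^{n-j+i} S_{[k,i]} · S^{(i+1)}_{[n-k-1,j-i-1]}`. -/
theorem stmt15 (p : ℕ) (hp : 1 ≤ p) (a : ℤ → ℂ) (i j n : ℕ)
    (hij : i < j) (hjp : j ≤ p) (hn : j ≤ n) :
    Spoly a p 0 n j =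
      ∑ k ∈ Finset.Icc i (n - j + i),
        Spoly a p 0 k i * Spoly a p ((i : ℤ) + 1) (n - k - 1) (j - i - 1) := by
  have h := Spoly_conv a p i n (j - i - 1)
  rw [show i + 1 + (j - i - 1) = j by omega] at h
  rw [h]
  symm
  apply Finset.sum_subset
  · intro k hk
    rw [Finset.mem_Icc] at hk
    rw [Finset.mem_range]; omega
  · intro k hk hk'
    rw [Finset.mem_range] at hk
    rw [Finset.mem_Icc] at hk'
    by_cases hki : k < i
    · rw [Spoly_lt a p 0 k i hki, zero_mul]
    · rw [Spoly_lt a p _ (n-k-1) (j-i-1) (by omega), mul_zero]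
end
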